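/- A weakly Ramsey non-selective ultrafilter U is f-quasi-selective for some f unbounded modulo U if and only if U is not rapid. -/

import Mathlib

def Nonprincipal (U : Ultrafilter ℕ) : Prop := ∀ A : Set ℕ, A.Finite → A ∉ U

def UnboundedModU (U : Ultrafilter ℕ) (f : ℕ → ℕ) : Prop := ∀ n : ℕ, {x | n < f x} ∈ U

def NondecrModU (U : Ultrafilter ℕ) (g : ℕ → ℕ) : Prop :=
  ∃ A ∈ U, ∀ x ∈ A, ∀ y ∈ A, x ≤ y → g x ≤ g y

def QSfor (U : Ultrafilter ℕ) (f : ℕ → ℕ) : Prop :=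
  ∀ g : ℕ → ℕ, {x | g x ≤ f x} ∈ U → NondecrModU U g

def Selective (U : Ultrafilter ℕ) : Prop := ∀ g : ℕ → ℕ, NondecrModU U g

def Rapid (U : Ultrafilter ℕ) : Prop :=
  ∀ g : ℕ → ℕ, StrictMono g → ∃ A ∈ U, ∀ n, 1 ≤ n → (A ∩ Set.Iic (g n)).ncard < n

def WeaklyRamsey (U : Ultrafilter ℕ) : Prop :=
  ∀ (k : ℕ) (c : ℕ → ℕ → Fin k), ∃ A ∈ U, ∃ i j : Fin k,
    ∀ x ∈ A, ∀ y ∈ A, x < y → c x y = i ∨ c x y = j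

def leU (U : Ultrafilter ℕ) (f g : ℕ → ℕ) : Prop := {x | f x ≤ g x} ∈ U

def QPoint (U : Ultrafilter ℕ) : Prop :=
  ∀ p : ℕ → ℕ, p 0 = 0 → StrictMono p →
    ∃ A ∈ U, ∀ n, (A ∩ Set.Ico (p n) (p (n+1))).Subsingleton

theorem backward_dir (U : Ultrafilter ℕ) (hNP : Nonprincipal U) (hWR : WeaklyRamsey U)
    (hR : ¬ Rapid U) : ∃ f : ℕ → ℕ, UnboundedModU U f ∧ QSfor U f := by
  classical
  have tail : ∀ m, {x : ℕ | m < x} ∈ U := by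
    intro m
    have h := hNP (Set.Iic m) (Set.finite_Iic m)
    rw [← Ultrafilter.compl_mem_iff_notMem] at h
    filter_upwards [h] with x hx
    simpa using hx
  unfold Rapid at hR
  push Not at hR
  obtain ⟨g, hg, hA⟩ := hR
  have ex : ∀ x, ∃ n, x ≤ g n := fun x => ⟨x, hg.id_le x⟩
  refine ⟨fun x => Nat.find (ex x) - 2, ?_, ?_⟩
  · intro m
    filter_upwards [tail (g (m+2))] with x hx
    have : m + 2 < Nat.find (ex x) := by
      rw [Nat.lt_find_iff]
      intro k hk
      have := hg.monotone hk
      omega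
    show m < Nat.find (ex x) - 2
    omega
  · intro h hh
    obtain ⟨A, hAU, i, j, hc⟩ := hWR 3
      (fun x y => if h x < h y then 0 else if h x = h y then 1 else 2)
    by_cases h1 : ∀ x ∈ A, ∀ y ∈ A, x ≤ y → h x ≤ h y
    · exact ⟨A, hAU, h1⟩
    by_cases h2 : ∀ x ∈ A, ∀ y ∈ A, x ≤ y → h y ≤ h x
    · have hne : ∃ v, ∃ a ∈ A, h a = v := by
        obtain ⟨a, ha⟩ := U.nonempty_of_mem hAU
        exact ⟨h a, a, ha, rfl⟩
      obtain ⟨a, ha, hav⟩ := Nat.find_spec hne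
      have hmin : ∀ y ∈ A, h a ≤ h y := by
        intro y hy
        rw [hav]
        exact Nat.find_min' hne ⟨y, hy, rfl⟩
      refine ⟨A ∩ {x | a < x}, Filter.inter_mem hAU (tail a), ?_⟩
      rintro x ⟨hx, hax⟩ y ⟨hy, hay⟩ _
      exact (h2 a ha x hx (le_of_lt hax)).trans (hmin y hy)
    exfalso
    push Not at h1 h2
    obtain ⟨x, hx, y, hy, hxy, hxy'⟩ := h1
    obtain ⟨z, hz, w, hw, hzw, hzw'⟩ := h2
    have lxy : x < y := lt_of_le_of_ne hxy (by rintro rfl; omega)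
    have lzw : z < w := lt_of_le_of_ne hzw (by rintro rfl; omega)
    have c1 := hc x hx y hy lxy
    have c2 := hc z hz w hw lzw
    simp only [if_neg (show ¬ h x < h y by omega), if_neg (show ¬ h x = h y by omega)] at c1
    simp only [if_pos hzw'] at c2
    have inj0 : ∀ u ∈ A, ∀ v ∈ A, u < v → h u ≠ h v := by
      intro u hu v hv huv he
      have c3 := hc u hu v hv huv
      simp only [he, lt_irrefl, if_true, if_false] at c3
      revert c1 c2 c3
      clear hc
      revert i j
      decide
    have inj : Set.InjOn h A := by
      intro u hu v hv he
      by_contra hne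
      rcases lt_or_gt_of_ne hne with hl | hl
      · exact inj0 u hu v hv hl he
      · exact inj0 v hv u hu hl he.symm
    obtain ⟨n, hn, hcard⟩ := hA ((A ∩ {x | h x ≤ Nat.find (ex x) - 2}) ∩ {x | g 1 < x})
      (Filter.inter_mem (Filter.inter_mem hAU hh) (tail _))
    set S := ((A ∩ {x | h x ≤ Nat.find (ex x) - 2}) ∩ {x | g 1 < x}) ∩ Set.Iic (g n) with hS
    have hfin : S.Finite := (Set.finite_Iic (g n)).subset Set.inter_subset_right
    have hn2 : 2 ≤ n := by
      by_contra hlt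
      have h1 : n = 1 := by omega
      subst h1
      have : S = ∅ := by
        ext x
        simp only [hS, Set.mem_inter_iff, Set.mem_ofPred_eq, Set.mem_Iic, Set.mem_empty_iff_false,
          iff_false]
        omega
      rw [this] at hcard
      simp at hcard
    have : S.ncard ≤ (Set.Iio (n-1)).ncard := by
      refine Set.ncard_le_ncard_of_injOn h ?_ ?_ (Set.finite_Iio _)
      · rintro x ⟨⟨⟨_, hx⟩, _⟩, hxn⟩
        have : Nat.find (ex x) ≤ n := Nat.find_min' (ex x) hxn
        simp only [Set.mem_ofPred_eq] at hx
        simp only [Set.mem_Iio]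
        omega
      · exact inj.mono (fun x hx => hx.1.1.1)
    have h3 : (Set.Iio (n-1)).ncard = n - 1 := by
      rw [← Finset.coe_Iio, Set.ncard_coe_finset]
      simp
    omega

theorem forward_dir (U : Ultrafilter ℕ) (f : ℕ → ℕ) (hf : UnboundedModU U f) (hQ : QSfor U f)
    (hR : Rapid U) : Selective U := by
  classical
  intro g
  by_cases hgf : {x | g x ≤ f x} ∈ U
  · exact hQ g hgf
  rw [← Ultrafilter.compl_mem_iff_notMem] at hgf
  obtain ⟨A, hAU, hA⟩ := hQ f (Filter.mem_of_superset Filter.univ_mem (fun x _ => le_refl (f x)))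
  have hM : ∀ N : ℕ, ∃ M, N < M ∧ ∀ y ∈ A, M ≤ y →
      N + 1 + ∑ x ∈ Finset.range (N+1), g x ≤ f y := by
    intro N
    obtain ⟨a, haA, ha⟩ := U.nonempty_of_mem
      (Filter.inter_mem hAU (hf (N + 1 + ∑ x ∈ Finset.range (N+1), g x)))
    refine ⟨a + N + 1, by omega, fun y hy hay => ?_⟩
    exact (le_of_lt ha).trans (hA a haA y hy (by omega))
  choose M hM1 hM2 using hM
  let p : ℕ → ℕ := fun n => Nat.rec 0 (fun _ r => M r) n
  have p0 : p 0 = 0 := rfl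
  have ps : ∀ n, p (n+1) = M (p n) := fun n => rfl
  have hp : StrictMono p := strictMono_nat_of_lt_succ (fun n => by rw [ps]; exact hM1 _)
  have hk : ∀ x, ∃ n, p n ≤ x ∧ x < p (n+1) := by
    intro x
    have ex : ∃ n, x < p (n+1) := ⟨x, lt_of_lt_of_le (Nat.lt_succ_self x) (hp.id_le (x+1))⟩
    refine ⟨Nat.find ex, ?_, Nat.find_spec ex⟩
    rcases hn : Nat.find ex with _ | m
    · simp [p0]
    · have := Nat.find_min ex (m := m) (by omega)
      omega
  choose k hk1 hk2 using hk
  have kmono : ∀ x y, x ≤ y → k x ≤ k y := by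
    intro x y hxy
    by_contra hlt
    have := hp.monotone (show k y + 1 ≤ k x by omega)
    have := hk1 x
    have := hk2 y
    omega
  obtain ⟨D, hDU, hD⟩ := hR (fun n => p (n+1)) (fun a b h => hp (Nat.succ_lt_succ h))
  let e : ℕ → ℕ := fun d => (D ∩ Set.Ioo d (p (k d + 1))).ncard
  have fin : ∀ n, (D ∩ Set.Iic n).Finite := fun n =>
    (Set.finite_Iic n).subset Set.inter_subset_right
  have fbig : ∀ y ∈ A, ∀ n, p (n+1) ≤ y → p n + 1 + ∑ x ∈ Finset.range (p n + 1), g x ≤ f y := by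
    intro y hy n hn
    exact hM2 (p n) y hy (by rw [← ps]; exact hn)
  have he : {x | e x ≤ f x} ∈ U := by
    filter_upwards [hAU, hDU] with d hdA hdD
    have kpos : 1 ≤ k d := by
      by_contra h0
      have h0 : k d = 0 := by omega
      have h1 := hD 1 le_rfl
      have h2 := hk2 d
      rw [h0] at h2
      have h3 : p (0+1) < p (1+1) := hp (by norm_num : 0 + 1 < 1 + 1)
      have : 0 < (D ∩ Set.Iic (p (1+1))).ncard := by
        rw [Set.ncard_pos (fin _)]
        exact ⟨d, hdD, by simp only [Set.mem_Iic]; omega⟩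
      omega
    have h1 := hD (k d) kpos
    have h2 : e d ≤ (D ∩ Set.Iic (p (k d + 1))).ncard := by
      refine Set.ncard_le_ncard ?_ (fin _)
      rintro z ⟨hz, hz1, hz2⟩
      exact ⟨hz, hz2.le⟩
    obtain ⟨m, hm⟩ : ∃ m, k d = m + 1 := ⟨k d - 1, by omega⟩
    have h3 := fbig d hdA m (by rw [← hm]; exact hk1 d)
    have h4 : m ≤ p m := hp.id_le m
    show e d ≤ f d
    omega
  obtain ⟨E, hEU, hE⟩ := hQ e he
  -- at most one point per interval
  have hone : ∀ x ∈ E ∩ D, ∀ y ∈ E ∩ D, x < y → k x < k y := by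
    rintro x ⟨hxE, hxD⟩ y ⟨hyE, hyD⟩ hxy
    refine lt_of_le_of_ne (kmono x y hxy.le) (fun hkk => ?_)
    have h1 := hE x hxE y hyE hxy.le
    have h2 : e y < e x := by
      refine Set.ncard_lt_ncard ?_ ((Set.finite_Ioo _ _).subset Set.inter_subset_right)
      rw [Set.ssubset_iff_of_subset]
      · refine ⟨y, ⟨hyD, hxy, ?_⟩, fun h => lt_irrefl _ h.2.1⟩
        rw [hkk]
        exact hk2 y
      · rintro z ⟨hz, hz1, hz2⟩
        refine ⟨hz, hxy.trans hz1, ?_⟩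
        rw [hkk]
        exact hz2
    omega
  have hpar : ∃ r, {x | k x % 2 = r} ∈ U := by
    by_cases h : {x | k x % 2 = 0} ∈ U
    · exact ⟨0, h⟩
    · rw [← Ultrafilter.compl_mem_iff_notMem] at h
      refine ⟨1, ?_⟩
      filter_upwards [h] with x hx
      simp only [Set.mem_compl_iff, Set.mem_ofPred_eq] at hx ⊢
      omega
  obtain ⟨r, hr⟩ := hpar
  refine ⟨_, Filter.inter_mem (Filter.inter_mem hEU hDU)
    (Filter.inter_mem hr (Filter.inter_mem hAU hgf)), ?_⟩
  rintro x ⟨hx1, hx2, hx3, hx4⟩ y ⟨hy1, hy2, hy3, hy4⟩ hxy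
  rcases eq_or_lt_of_le hxy with rfl | hlt
  · exact le_rfl
  have h1 := hone x hx1 y hy1 hlt
  simp only [Set.mem_compl_iff, Set.mem_ofPred_eq, not_le] at hx2 hy2 hx4 hy4
  have h2 : k x + 1 + 1 ≤ k y := by omega
  have h3 := fbig y hy3 (k x + 1) ((hp.monotone h2).trans (hk1 y))
  have h4 : g x ≤ ∑ z ∈ Finset.range (p (k x + 1) + 1), g z :=
    Finset.single_le_sum (f := g) (fun _ _ => Nat.zero_le _)
      (by have := hk2 x; simp only [Finset.mem_range]; omega)
  omega

theorem stmt17 (U : Ultrafilter ℕ) (hNP : Nonprincipal U) (hWR : WeaklyRamsey U)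
    (hns : ¬ Selective U) :
    (∃ f : ℕ → ℕ, UnboundedModU U f ∧ QSfor U f) ↔ ¬ Rapid U := by
  constructor
  · rintro ⟨f, hf, hQ⟩ hR
    exact hns (forward_dir U f hf hQ hR)
  · exact backward_dir U hNP hWR
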